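/- arXiv:1112.0283 — 13 statements merged into one kernel-verified Lean document; each statement's English description precedes it below -/
import Mathlib

section
/- Let ℓ, h be natural numbers with 1 ≤ h ≤ ℓ, and set D = ∑_{a=1}^{h} C(ℓ−1, a−1). Then the minimum distance of the binary h-skeleton code K(ℓ,h,1) equals D; that is, every nonzero codeword c ∈ K(ℓ,h,1) has Hamming weight at least D, and there exists a codeword in K(ℓ,h,1) whose Hamming weight is exactly D. -/
open Finset

/-- The support size (number of nonzero coordinates) of a vector over `ZMod 2`. -/
def suppCard {ℓ : ℕ} (v : Fin ℓ → ZMod 2) : ℕ :=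
  (univ.filter fun i => v i ≠ 0).card

/-- The evaluation linear map sending a multivariate polynomial to its values on the
points of `Fin ℓ → ZMod 2` with at most `h` nonzero coordinates. -/
noncomputable def evalMap (ℓ h : ℕ) :
    MvPolynomial (Fin ℓ) (ZMod 2) →ₗ[ZMod 2]
      ({v : Fin ℓ → ZMod 2 // suppCard v ≤ h} → ZMod 2) where
  toFun f := fun p => MvPolynomial.eval p.1 f
  map_add' f g := by funext p; simp
  map_smul' c f := by funext p; simp

/-- The binary `h`-skeleton code `K(ℓ, h, j)`: the image under evaluation of the
polynomials over `ZMod 2` of total degree at most `j`. -/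
noncomputable def skelCode (ℓ h j : ℕ) :
    Submodule (ZMod 2) ({v : Fin ℓ → ZMod 2 // suppCard v ≤ h} → ZMod 2) :=
  (MvPolynomial.restrictTotalDegree (Fin ℓ) (ZMod 2) j).map (evalMap ℓ h)

/-- The Hamming weight of a codeword. -/
def hammingWt {ℓ h : ℕ} (c : {v : Fin ℓ → ZMod 2 // suppCard v ≤ h} → ZMod 2) : ℕ :=
  (univ.filter fun p => c p ≠ 0).card

/-- A polynomial of total degree at most one evaluates as an affine form. -/
theorem exists_affine_of_totalDegree_le_one {σ R : Type*} [Fintype σ] [CommSemiring R]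
    (f : MvPolynomial σ R) (hf : f.totalDegree ≤ 1) :
    ∃ (c : R) (a : σ → R), ∀ v, MvPolynomial.eval v f = c + ∑ j, a j * v j := by
  classical
  rw [f.as_sum]
  refine Finset.sum_induction _
    (fun g => ∃ (c : R) (a : σ → R), ∀ v, MvPolynomial.eval v g = c + ∑ j, a j * v j) ?_ ?_ ?_
  · rintro g g' ⟨c, a, h⟩ ⟨c', a', h'⟩
    refine ⟨c + c', a + a', fun v => ?_⟩
    simp only [map_add, h, h', Pi.add_apply, add_mul, Finset.sum_add_distrib]
    ring
  · exact ⟨0, 0, fun v => by simp⟩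
  · intro d hd
    have hdeg : d.degree ≤ 1 := (MvPolynomial.le_totalDegree hd).trans hf
    obtain h0 | h1 := Nat.le_one_iff_eq_zero_or_eq_one.mp hdeg
    · rw [Finsupp.degree_eq_zero_iff] at h0
      exact ⟨f.coeff d, 0, fun v => by simp [h0]⟩
    · obtain ⟨i, rfl⟩ := (Finsupp.sum_eq_one_iff d).mp h1
      exact ⟨0, Pi.single i (f.coeff (Finsupp.single i 1)), fun v => by
        simp [MvPolynomial.eval_monomial, Pi.single_apply, ite_mul]⟩

/-- A nonzero element of `ZMod 2` is one. -/
theorem zmod_two_eq_one_of_ne_zero : ∀ x : ZMod 2, x ≠ 0 → x = 1 := by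
  decide

/-- The support size of the indicator vector of a finset is its cardinality. -/
theorem suppCard_indicator {ℓ : ℕ} (s : Finset (Fin ℓ)) :
    suppCard (fun j => if j ∈ s then 1 else 0) = s.card := by
  simp [suppCard]

/-- The number of vectors with at most `h` nonzero coordinates whose `i`-th coordinate is
nonzero. -/
theorem card_filter_coord_ne_zero {ℓ : ℕ} (h : ℕ) (i : Fin ℓ) :
    (univ.filter fun p : {v : Fin ℓ → ZMod 2 // suppCard v ≤ h} => p.1 i ≠ 0).card =
      ∑ a ∈ Icc 1 h, (ℓ - 1).choose (a - 1) := by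
  rw [Finset.card_eq_sum_card_fiberwise (f := fun p => suppCard p.1) (t := Icc 1 h)]
  · refine Finset.sum_congr rfl fun a ha => ?_
    obtain ⟨ha1, hah⟩ := Finset.mem_Icc.mp ha
    have hcard : (ℓ - 1).choose (a - 1) = (powersetCard (a - 1) (univ.erase i)).card := by
      simp
    rw [hcard]
    refine Finset.card_bij' (fun p _ => (univ.filter fun j => p.1 j ≠ 0).erase i)
      (fun s hs => ⟨fun j => if j ∈ insert i s then 1 else 0, ?_⟩) ?_ ?_ ?_ ?_
    · obtain ⟨hs, hsa⟩ := Finset.mem_powersetCard.mp hs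
      have hi : i ∉ s := fun hi => by simpa using hs hi
      rw [suppCard_indicator, Finset.card_insert_of_notMem hi]
      lia
    · intro p hp
      simp only [Finset.mem_filter, Finset.mem_univ, true_and] at hp
      refine Finset.mem_powersetCard.mpr ⟨Finset.erase_subset_erase _ (Finset.subset_univ _), ?_⟩
      rw [Finset.card_erase_of_mem (by simpa using hp.1), ← hp.2, suppCard]
    · intro s hs
      obtain ⟨hs, hsa⟩ := Finset.mem_powersetCard.mp hs
      have hi : i ∉ s := fun hi => by simpa using hs hi
      simp only [Finset.mem_filter, Finset.mem_univ, true_and, suppCard_indicator,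
        Finset.card_insert_of_notMem hi]
      exact ⟨by simp, by lia⟩
    · intro p hp
      simp only [Finset.mem_filter, Finset.mem_univ, true_and] at hp
      ext j : 2
      by_cases hj : p.1 j = 0
      · have hji : j ≠ i := fun hji => hp.1 (hji ▸ hj)
        simp [hj, hji]
      · simp [em, zmod_two_eq_one_of_ne_zero _ hj]
    · intro s hs
      obtain ⟨hs, -⟩ := Finset.mem_powersetCard.mp hs
      have hi : i ∉ s := fun hi => by simpa using hs hi
      ext j
      by_cases hj : j = i <;> simp [hj, hi]
  · intro p hp
    have hp : p.1 i ≠ 0 := by simpa using hp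
    exact Finset.mem_coe.mpr (Finset.mem_Icc.mpr
      ⟨Finset.card_pos.mpr ⟨i, by simpa using hp⟩, p.2⟩)

/-- Zeroing a coordinate does not increase the support size. -/
theorem suppCard_update_zero_le {ℓ : ℕ} (v : Fin ℓ → ZMod 2) (i : Fin ℓ) :
    suppCard (Function.update v i 0) ≤ suppCard v := by
  refine Finset.card_le_card fun j => ?_
  by_cases hj : j = i
  · simp [hj]
  · simp [hj]

/-- If zeroing the `i`-th coordinate turns every zero of `c` with nonzero `i`-th coordinate into
a nonzero, then `c` has at least as many nonzeros as there are points with nonzero `i`-th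
coordinate. -/
theorem card_filter_coord_ne_zero_le_hammingWt {ℓ h : ℕ}
    (c : {v : Fin ℓ → ZMod 2 // suppCard v ≤ h} → ZMod 2) (i : Fin ℓ)
    (hc : ∀ p, p.1 i ≠ 0 → c p = 0 →
      c ⟨Function.update p.1 i 0, (suppCard_update_zero_le p.1 i).trans p.2⟩ ≠ 0) :
    (univ.filter fun p : {v : Fin ℓ → ZMod 2 // suppCard v ≤ h} => p.1 i ≠ 0).card ≤
      hammingWt c := by
  refine Finset.card_le_card_of_injOn
    (fun p => if c p = 0 then
      ⟨Function.update p.1 i 0, (suppCard_update_zero_le p.1 i).trans p.2⟩ else p) ?_ ?_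
  · intro p hp
    have hp : p.1 i ≠ 0 := by simpa using hp
    by_cases h0 : c p = 0
    · simpa [h0] using hc p hp h0
    · simp [h0]
  · intro p hp q hq hpq
    have hp : p.1 i = 1 := zmod_two_eq_one_of_ne_zero _ (by simpa using hp)
    have hq : q.1 i = 1 := zmod_two_eq_one_of_ne_zero _ (by simpa using hq)
    have key : ∀ r : {v : Fin ℓ → ZMod 2 // suppCard v ≤ h}, r.1 i = 1 →
        Function.update (if c r = 0 then
          (⟨Function.update r.1 i 0, (suppCard_update_zero_le r.1 i).trans r.2⟩ :
            {v : Fin ℓ → ZMod 2 // suppCard v ≤ h}) else r).1 i 1 = r.1 := by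
      intro r hr
      split_ifs <;> simp [← hr]
    apply Subtype.ext
    rw [← key p hp, ← key q hq]
    exact congrArg (fun r => Function.update r.1 i 1) hpq

theorem min_distance_skeleton_j_one (ℓ h : ℕ) (h1 : 1 ≤ h) (hℓ : h ≤ ℓ) :
    (∀ c ∈ skelCode ℓ h 1, c ≠ 0 →
        ∑ a ∈ Icc 1 h, (ℓ - 1).choose (a - 1) ≤ hammingWt c) ∧
    (∃ c ∈ skelCode ℓ h 1, hammingWt c = ∑ a ∈ Icc 1 h, (ℓ - 1).choose (a - 1)) := by
  have i₀ : Fin ℓ := ⟨0, h1.trans hℓ⟩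
  constructor
  · rintro _ ⟨f, hf, rfl⟩ hne
    obtain ⟨b, a, hab⟩ := exists_affine_of_totalDegree_le_one f
      ((MvPolynomial.mem_restrictTotalDegree _ _ _).mp hf)
    have heval : ∀ p, evalMap ℓ h f p = b + ∑ j, a j * p.1 j := fun p => hab p.1
    by_cases ha : ∀ i, a i = 0
    · rw [← card_filter_coord_ne_zero h i₀]
      refine card_filter_coord_ne_zero_le_hammingWt _ i₀ fun p _ hp => absurd ?_ hne
      ext q
      simp only [heval, ha, zero_mul, Finset.sum_const_zero, add_zero] at hp ⊢
      simpa using hp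
    · push Not at ha
      obtain ⟨i, hi⟩ := ha
      rw [← card_filter_coord_ne_zero h i]
      refine card_filter_coord_ne_zero_le_hammingWt _ i fun p hpi hp hp' => ?_
      have hsum : ∑ j, a j * (p.1 j - Function.update p.1 i 0 j) = a i * p.1 i := by
        rw [Finset.sum_eq_single i (fun j _ hj => by simp [hj]) (by simp)]
        simp
      refine mul_ne_zero hi hpi ?_
      rw [heval] at hp hp'
      simp only [mul_sub, Finset.sum_sub_distrib] at hsum
      rw [← hsum]
      linear_combination hp - hp'
  · refine ⟨evalMap ℓ h (MvPolynomial.X i₀), Submodule.mem_map_of_mem ?_, ?_⟩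
    · simp [MvPolynomial.mem_restrictTotalDegree, MvPolynomial.totalDegree_X]
    · rw [← card_filter_coord_ne_zero h i₀]
      simp [hammingWt, evalMap]
end

section
/- Let ℓ, h, j be natural numbers with j ≤ h ≤ ℓ. Then the dimension of the binary h-skeleton code K(ℓ,h,j) as a vector space over ZMod 2 (its finrank) equals ∑_{i=0}^{j} C(ℓ, i). -/
open Finset

open MvPolynomial

/-- The value table of the squarefree monomial `∏ i ∈ S, X i` on the `h`-skeleton. -/
noncomputable def skelMonomial {ℓ : ℕ} (h : ℕ) (S : Finset (Fin ℓ)) :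
    {v : Fin ℓ → ZMod 2 // suppCard v ≤ h} → ZMod 2 :=
  evalMap ℓ h (∏ i ∈ S, X i)

lemma skelMonomial_apply {ℓ h : ℕ} (S : Finset (Fin ℓ))
    (p : {v : Fin ℓ → ZMod 2 // suppCard v ≤ h}) :
    skelMonomial h S p = ∏ i ∈ S, p.1 i := by
  simp [skelMonomial, evalMap]

/-- Nonzero powers are trivial over `ZMod 2`, so a monomial takes the same values as the squarefree
monomial on its support. -/
lemma evalMap_monomial_one {ℓ : ℕ} (h : ℕ) (d : Fin ℓ →₀ ℕ) :
    evalMap ℓ h (monomial d 1) = skelMonomial h d.support := by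
  funext p
  rw [skelMonomial_apply]
  simp only [evalMap, LinearMap.coe_mk, AddHom.coe_mk, eval_monomial, one_mul, Finsupp.prod]
  refine Finset.prod_congr rfl fun i hi => ?_
  have hd : d i ≠ 0 := Finsupp.mem_support_iff.mp hi
  generalize p.1 i = x
  fin_cases x
  · exact zero_pow hd
  · exact one_pow _

lemma skelCode_eq_span (ℓ h j : ℕ) :
    skelCode ℓ h j = Submodule.span (ZMod 2)
      (Set.range fun S : {S : Finset (Fin ℓ) // S.card ≤ j} => skelMonomial h S.1) := by
  apply le_antisymm
  · rintro _ ⟨f, hf, rfl⟩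
    rw [SetLike.mem_coe, mem_restrictTotalDegree] at hf
    rw [f.as_sum, map_sum]
    refine Submodule.sum_mem _ fun d hd => ?_
    rw [← mul_one (coeff d f), ← smul_eq_mul, ← smul_monomial, map_smul, evalMap_monomial_one]
    refine Submodule.smul_mem _ _ (Submodule.subset_span ⟨⟨d.support, ?_⟩, rfl⟩)
    calc d.support.card = ∑ i ∈ d.support, 1 := by simp
      _ ≤ ∑ i ∈ d.support, d i := Finset.sum_le_sum fun i hi =>
          Nat.one_le_iff_ne_zero.mpr (Finsupp.mem_support_iff.mp hi)
      _ ≤ j := (le_totalDegree hd).trans hf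
  · rw [Submodule.span_le]
    rintro _ ⟨⟨S, hS⟩, rfl⟩
    refine ⟨∏ i ∈ S, X i, ?_, rfl⟩
    rw [SetLike.mem_coe, mem_restrictTotalDegree]
    refine (totalDegree_finsetProd S _).trans ?_
    simpa using hS

lemma linearIndependent_skelMonomial {ℓ h j : ℕ} (hj : j ≤ h) :
    LinearIndependent (ZMod 2)
      fun S : {S : Finset (Fin ℓ) // S.card ≤ j} => skelMonomial h S.1 := by
  rw [Fintype.linearIndependent_iff]
  rintro c hc ⟨S, hS⟩
  induction S using Finset.strongInduction with
  | H S ih =>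
    -- evaluate at the indicator vector of `S`, where only the monomials `T ⊆ S` survive
    have hp : suppCard (fun i : Fin ℓ => if i ∈ S then (1 : ZMod 2) else 0) ≤ h := by
      simpa [suppCard] using hS.trans hj
    have hval := congrFun hc ⟨_, hp⟩
    simp only [Finset.sum_apply, Pi.smul_apply, skelMonomial_apply, smul_eq_mul,
      Pi.zero_apply] at hval
    rw [Finset.sum_eq_single ⟨S, hS⟩] at hval
    · rwa [Finset.prod_congr rfl fun i hi => if_pos hi, Finset.prod_const_one, mul_one] at hval
    · rintro ⟨T, hT⟩ - hne
      by_cases hTS : T ⊆ S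
      · rw [ih T (hTS.ssubset_of_ne fun e => hne (Subtype.ext e)) hT, zero_mul]
      · obtain ⟨i, hiT, hiS⟩ := Finset.not_subset.mp hTS
        rw [Finset.prod_eq_zero hiT (if_neg hiS), mul_zero]
    · simp

lemma card_finset_card_le (ℓ j : ℕ) :
    Fintype.card {S : Finset (Fin ℓ) // S.card ≤ j} = ∑ i ∈ Finset.range (j + 1), ℓ.choose i := by
  rw [Fintype.card_subtype, Finset.card_eq_sum_card_fiberwise (f := Finset.card)
    (t := Finset.range (j + 1)) (fun S hS => by simpa [Nat.lt_succ_iff] using hS)]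
  refine Finset.sum_congr rfl fun i hi => ?_
  have hi : i ≤ j := Nat.lt_succ_iff.mp (Finset.mem_range.mp hi)
  calc _ = (Finset.powersetCard i (Finset.univ : Finset (Fin ℓ))).card := by
        congr 1
        ext S
        simp only [Finset.mem_filter, Finset.mem_univ, true_and, Finset.mem_powersetCard,
          Finset.subset_univ]
        exact ⟨fun hS => hS.2, fun hS => ⟨hS.trans_le hi, hS⟩⟩
    _ = ℓ.choose i := by simp

theorem skeleton_code_dimension (ℓ h j : ℕ) (hj : j ≤ h) (hℓ : h ≤ ℓ) :
    Module.finrank (ZMod 2) (skelCode ℓ h j) =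
      ∑ i ∈ Finset.range (j + 1), ℓ.choose i := by
  rw [skelCode_eq_span, finrank_span_eq_card (linearIndependent_skelMonomial hj),
    card_finset_card_le]
end

section
/- Let Δ be a simplicial complex on Fin ℓ and let j be a natural number. Then the dimension of the simplicial evaluation code C(Δ,j) as a vector space over ZMod 2 (its finrank) equals the number of faces σ ∈ Δ with |σ| ≤ j (counting the empty face); equivalently, it equals ∑_{i=0}^{s} f_i, where f_i is the number of faces of Δ of cardinality i, f_0 = 1, and s = min(j, maximal cardinality of a face of Δ). -/
open Finset

/-- The support of a vector over `ZMod 2`, as a finset. -/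
def suppF {ℓ : ℕ} (v : Fin ℓ → ZMod 2) : Finset (Fin ℓ) :=
  univ.filter fun i => v i ≠ 0

/-- The evaluation linear map sending a multivariate polynomial to its values on the
points of the coordinate subspace arrangement of a simplicial complex `Δ`. -/
noncomputable def evalMapΔ {ℓ : ℕ} (Δ : Finset (Finset (Fin ℓ))) :
    MvPolynomial (Fin ℓ) (ZMod 2) →ₗ[ZMod 2]
      ({v : Fin ℓ → ZMod 2 // suppF v ∈ Δ} → ZMod 2) where
  toFun f := fun p => MvPolynomial.eval p.1 f
  map_add' f g := by funext p; simp
  map_smul' c f := by funext p; simp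

/-- The simplicial evaluation code `C(Δ, j)`. -/
noncomputable def simpCode {ℓ : ℕ} (Δ : Finset (Finset (Fin ℓ))) (j : ℕ) :
    Submodule (ZMod 2) ({v : Fin ℓ → ZMod 2 // suppF v ∈ Δ} → ZMod 2) :=
  (MvPolynomial.restrictTotalDegree (Fin ℓ) (ZMod 2) j).map (evalMapΔ Δ)

/-- The function on the points of `Δ` indicating whether the support contains `σ`. -/
def faceIndicator {ℓ : ℕ} (Δ : Finset (Finset (Fin ℓ))) (σ : Finset (Fin ℓ)) :
    {v : Fin ℓ → ZMod 2 // suppF v ∈ Δ} → ZMod 2 :=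
  fun p => if σ ⊆ suppF p.1 then 1 else 0

theorem suppF_indicator {ℓ : ℕ} (σ : Finset (Fin ℓ)) :
    suppF (fun i => if i ∈ σ then 1 else 0) = σ := by
  ext i
  simp [suppF]

theorem evalMapΔ_monomial_one {ℓ : ℕ} (Δ : Finset (Finset (Fin ℓ))) (m : Fin ℓ →₀ ℕ) :
    evalMapΔ Δ (MvPolynomial.monomial m 1) = faceIndicator Δ m.support := by
  funext p
  change MvPolynomial.eval p.1 (MvPolynomial.monomial m 1) = _
  rw [MvPolynomial.eval_monomial, one_mul, faceIndicator, Finsupp.prod]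
  split_ifs with h
  · refine Finset.prod_eq_one fun i hi => ?_
    have hp : p.1 i ≠ 0 := by simpa [suppF] using h hi
    have hone : p.1 i = 1 := Fin.eq_one_of_ne_zero (p.1 i) hp
    rw [hone, one_pow]
  · obtain ⟨i, hi, hip⟩ := Finset.not_subset.1 h
    refine Finset.prod_eq_zero hi ?_
    have hp : p.1 i = 0 := by simpa [suppF] using hip
    rw [hp, zero_pow (Finsupp.mem_support_iff.1 hi)]

theorem faceIndicator_eq_zero {ℓ : ℕ} {Δ : Finset (Finset (Fin ℓ))}
    (hdown : ∀ σ ∈ Δ, ∀ τ ⊆ σ, τ ∈ Δ) {σ : Finset (Fin ℓ)} (hσ : σ ∉ Δ) :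
    faceIndicator Δ σ = 0 := by
  funext p
  exact if_neg fun h => hσ (hdown _ p.2 _ h)

theorem linearIndependent_faceIndicator {ℓ : ℕ} (Δ S : Finset (Finset (Fin ℓ))) (hS : S ⊆ Δ) :
    LinearIndependent (ZMod 2) fun σ : S => faceIndicator Δ σ.1 := by
  rw [Fintype.linearIndependent_iff]
  intro c hc
  suffices H : ∀ (σ : Finset (Fin ℓ)) (h : σ ∈ S), c ⟨σ, h⟩ = 0 from fun σ => H σ.1 σ.2
  intro σ
  induction σ using Finset.strongInduction with
  | H σ ih =>
    intro h
    have hp := congrFun hc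
      ⟨fun i => if i ∈ σ then 1 else 0, (suppF_indicator σ).symm ▸ hS h⟩
    rw [Finset.sum_apply, Finset.sum_eq_single ⟨σ, h⟩] at hp
    · simpa [faceIndicator, suppF_indicator] using hp
    · rintro ⟨τ, hτ⟩ - hne
      by_cases hsub : τ ⊆ σ
      · have hlt : τ ⊂ σ := hsub.ssubset_of_ne fun e => hne (Subtype.ext e)
        simp [ih τ hlt hτ]
      · simp [faceIndicator, suppF_indicator, hsub]
    · simp

theorem simpCode_eq_span {ℓ : ℕ} (Δ : Finset (Finset (Fin ℓ)))
    (hdown : ∀ σ ∈ Δ, ∀ τ ⊆ σ, τ ∈ Δ) (j : ℕ) :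
    simpCode Δ j = Submodule.span (ZMod 2) (Set.range
      fun σ : (Δ.filter fun σ => σ.card ≤ j : Finset _) => faceIndicator Δ σ.1) := by
  apply le_antisymm
  · rintro _ ⟨f, hf, rfl⟩
    have hdeg : f.totalDegree ≤ j := (MvPolynomial.mem_restrictTotalDegree _ _ _).1 hf
    rw [f.as_sum, map_sum]
    refine Submodule.sum_mem _ fun m hm => ?_
    rw [← mul_one (f.coeff m), ← smul_eq_mul, ← MvPolynomial.smul_monomial, map_smul,
      evalMapΔ_monomial_one]
    refine Submodule.smul_mem _ _ ?_
    by_cases hΔ : m.support ∈ Δ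
    · have hcard : m.support.card ≤ j := by
        refine le_trans ?_ ((MvPolynomial.le_totalDegree hm).trans hdeg)
        rw [Finset.card_eq_sum_ones]
        exact Finset.sum_le_sum fun i hi =>
          Nat.one_le_iff_ne_zero.2 (Finsupp.mem_support_iff.1 hi)
      exact Submodule.subset_span ⟨⟨m.support, Finset.mem_filter.2 ⟨hΔ, hcard⟩⟩, rfl⟩
    · rw [faceIndicator_eq_zero hdown hΔ]
      exact Submodule.zero_mem _
  · rw [Submodule.span_le]
    rintro _ ⟨⟨σ, hσ⟩, rfl⟩
    have hsupp : (Finsupp.indicator σ fun _ _ => (1 : ℕ)).support = σ := by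
      ext i
      simp [Finsupp.indicator_apply]
    refine ⟨MvPolynomial.monomial (Finsupp.indicator σ fun _ _ => 1) 1, ?_, ?_⟩
    · refine (MvPolynomial.mem_restrictTotalDegree _ _ _).2 ?_
      rw [MvPolynomial.totalDegree_monomial _ one_ne_zero, Finsupp.sum, hsupp]
      refine le_trans (le_of_eq ?_) (Finset.mem_filter.1 hσ).2
      rw [Finset.card_eq_sum_ones]
      exact Finset.sum_congr rfl fun i hi => by simp [Finsupp.indicator_apply, hi]
    · rw [evalMapΔ_monomial_one, hsupp]

theorem card_filter_card_le_eq_sum {α : Type*} (Δ : Finset (Finset α)) (j : ℕ) :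
    (Δ.filter fun σ => σ.card ≤ j).card =
      ∑ i ∈ Finset.range (min j (Δ.sup Finset.card) + 1),
        (Δ.filter fun σ => σ.card = i).card := by
  rw [Finset.card_eq_sum_card_fiberwise (f := Finset.card)
    (t := Finset.range (min j (Δ.sup Finset.card) + 1))]
  · refine Finset.sum_congr rfl fun i hi => ?_
    rw [Finset.filter_filter]
    congr 1
    refine Finset.filter_congr fun σ _ => ?_
    have := Finset.mem_range.1 hi
    omega
  · intro σ hσ
    obtain ⟨hΔ, hj⟩ := Finset.mem_filter.1 (Finset.mem_coe.1 hσ)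
    have := Finset.le_sup (f := Finset.card) hΔ
    simp only [Finset.coe_range, Set.mem_Iio]
    omega

theorem simplicial_code_dimension {ℓ : ℕ} (Δ : Finset (Finset (Fin ℓ)))
    (hempty : ∅ ∈ Δ) (hdown : ∀ σ ∈ Δ, ∀ τ ⊆ σ, τ ∈ Δ) (j : ℕ) :
    Module.finrank (ZMod 2) (simpCode Δ j) =
        (Δ.filter fun σ => σ.card ≤ j).card ∧
      (Δ.filter fun σ => σ.card ≤ j).card =
        ∑ i ∈ Finset.range (min j (Δ.sup Finset.card) + 1),
          (Δ.filter fun σ => σ.card = i).card := by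
  refine ⟨?_, card_filter_card_le_eq_sum Δ j⟩
  rw [simpCode_eq_span Δ hdown j, finrank_span_eq_card
    (linearIndependent_faceIndicator Δ _ (Finset.filter_subset _ _)), Fintype.card_coe]
end

section
/- Let ℓ, h, j be natural numbers with 1 ≤ j ≤ h ≤ ℓ. Then there exists a nonzero codeword of the binary h-skeleton code K(ℓ,h,j) whose Hamming weight equals ∑_{i=0}^{h−j} C(ℓ−j, i); consequently, the minimum distance d of K(ℓ,h,j) satisfies d ≤ ∑_{i=0}^{h−j} C(ℓ−j, i). -/
open Finset

/-- The minimum distance of a linear code: the least Hamming weight of a nonzero codeword. -/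
noncomputable def minDist {ℓ h : ℕ}
    (C : Submodule (ZMod 2) ({v : Fin ℓ → ZMod 2 // suppCard v ≤ h} → ZMod 2)) : ℕ :=
  sInf {w : ℕ | ∃ c ∈ C, c ≠ 0 ∧ hammingWt c = w}

/-- The number of subsets of `s` with fewer than `n` elements. -/
lemma card_powerset_filter_card_lt {α : Type*} [DecidableEq α] (s : Finset α) (n : ℕ) :
    (s.powerset.filter fun t => t.card < n).card = ∑ i ∈ Finset.range n, s.card.choose i := by
  rw [Finset.card_eq_sum_card_fiberwise (f := Finset.card) (t := Finset.range n)]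
  · refine Finset.sum_congr rfl fun i hi => ?_
    rw [← Finset.card_powersetCard]
    congr 1
    ext t
    simp only [Finset.mem_range] at hi
    simp only [Finset.mem_filter, Finset.mem_powerset, Finset.mem_powersetCard]
    constructor
    · rintro ⟨⟨h1, -⟩, h2⟩
      exact ⟨h1, h2⟩
    · rintro ⟨h1, h2⟩
      exact ⟨⟨h1, h2 ▸ hi⟩, h2⟩
  · intro t ht
    simp only [Finset.coe_filter, Set.mem_ofPred_eq] at ht
    simpa using ht.2

/-- The number of supersets of `S` with at most `h` elements. -/
lemma card_filter_superset_card_le {α : Type*} [Fintype α] [DecidableEq α] (S : Finset α)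
    {h : ℕ} (hS : S.card ≤ h) :
    (univ.filter fun T : Finset α => S ⊆ T ∧ T.card ≤ h).card =
      ∑ i ∈ Finset.range (h - S.card + 1), (Fintype.card α - S.card).choose i := by
  rw [← Finset.card_compl, ← card_powerset_filter_card_lt]
  refine Finset.card_nbij' (fun T => T \ S) (fun T => T ∪ S) ?_ ?_ ?_ ?_
  · intro T hT
    simp only [Finset.coe_filter, Finset.mem_univ, true_and, Set.mem_ofPred_eq] at hT
    simp only [Finset.coe_filter, Finset.mem_powerset, Set.mem_ofPred_eq,
      Finset.card_sdiff_of_subset hT.1]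
    refine ⟨fun x hx => ?_, by omega⟩
    simp only [Finset.mem_sdiff] at hx
    simpa using hx.2
  · intro T hT
    simp only [Finset.coe_filter, Finset.mem_powerset, Set.mem_ofPred_eq] at hT
    simp only [Finset.coe_filter, Finset.mem_univ, true_and, Set.mem_ofPred_eq]
    have := Finset.card_union_le T S
    exact ⟨Finset.subset_union_right, by omega⟩
  · intro T hT
    simp only [Finset.coe_filter, Finset.mem_univ, true_and, Set.mem_ofPred_eq] at hT
    exact Finset.sdiff_union_of_subset hT.1
  · intro T hT
    simp only [Finset.coe_filter, Finset.mem_powerset, Set.mem_ofPred_eq] at hT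
    exact Finset.union_sdiff_cancel_right
      (Finset.disjoint_left.2 fun x hx => Finset.mem_compl.1 (hT.1 hx))

/-- The squarefree monomial `∏ i ∈ S, X i` vanishes at `v` unless `S ⊆ supp v`, so its weight
counts the supersets of `S` with at most `h` elements. -/
lemma hammingWt_evalMap_prod_X {ℓ h : ℕ} (S : Finset (Fin ℓ)) :
    hammingWt (evalMap ℓ h (∏ i ∈ S, MvPolynomial.X i)) =
      (univ.filter fun T : Finset (Fin ℓ) => S ⊆ T ∧ T.card ≤ h).card := by
  have heval (p : {v : Fin ℓ → ZMod 2 // suppCard v ≤ h}) :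
      evalMap ℓ h (∏ i ∈ S, MvPolynomial.X i) p ≠ 0 ↔ S ⊆ univ.filter fun i => p.1 i ≠ 0 := by
    simp [evalMap, Finset.prod_eq_zero_iff, Finset.subset_iff]
  unfold hammingWt
  refine Finset.card_bij (fun p _ => univ.filter fun i => p.1 i ≠ 0) ?_ ?_ ?_
  · intro p hp
    simp only [Finset.mem_filter, Finset.mem_univ, true_and] at hp
    exact Finset.mem_filter.2 ⟨Finset.mem_univ _, (heval p).1 hp, p.2⟩
  · intro p _ q _ hpq
    refine Subtype.ext (funext fun i => ?_)
    have hi : p.1 i ≠ 0 ↔ q.1 i ≠ 0 := by simpa using Finset.ext_iff.1 hpq i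
    have two (a b : ZMod 2) : (a ≠ 0 ↔ b ≠ 0) → a = b := by revert a b; decide
    exact two _ _ hi
  · intro T hT
    simp only [Finset.mem_filter, Finset.mem_univ, true_and] at hT
    have hsupp : (univ.filter fun i => (if i ∈ T then (1 : ZMod 2) else 0) ≠ 0) = T := by
      ext i
      simp
    refine ⟨⟨fun i => if i ∈ T then 1 else 0, ?_⟩, ?_, hsupp⟩
    · unfold suppCard
      rw [hsupp]
      exact hT.2
    · refine Finset.mem_filter.2 ⟨Finset.mem_univ _, (heval _).2 ?_⟩
      rw [hsupp]
      exact hT.1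

lemma evalMap_prod_X_mem_skelCode {ℓ h : ℕ} (S : Finset (Fin ℓ)) :
    evalMap ℓ h (∏ i ∈ S, MvPolynomial.X i) ∈ skelCode ℓ h S.card := by
  refine Submodule.mem_map_of_mem ((MvPolynomial.mem_restrictTotalDegree _ _ _).2 ?_)
  refine (MvPolynomial.totalDegree_finsetProd _ _).trans ?_
  simp

theorem skeleton_min_distance_upper_bound (ℓ h j : ℕ)
    (hj1 : 1 ≤ j) (hjh : j ≤ h) (hhl : h ≤ ℓ) :
    (∃ c ∈ skelCode ℓ h j, c ≠ 0 ∧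
        hammingWt c = ∑ i ∈ Finset.range (h - j + 1), (ℓ - j).choose i) ∧
      minDist (skelCode ℓ h j) ≤ ∑ i ∈ Finset.range (h - j + 1), (ℓ - j).choose i := by
  have hex : ∃ c ∈ skelCode ℓ h j, c ≠ 0 ∧
      hammingWt c = ∑ i ∈ Finset.range (h - j + 1), (ℓ - j).choose i := by
    obtain ⟨S, -, rfl⟩ := Finset.exists_subset_card_eq
      (show j ≤ (univ : Finset (Fin ℓ)).card by simpa using hjh.trans hhl)
    have hwt := (hammingWt_evalMap_prod_X (h := h) S).trans (card_filter_superset_card_le S hjh)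
    rw [Fintype.card_fin] at hwt
    refine ⟨_, evalMap_prod_X_mem_skelCode S, fun hzero => ?_, hwt⟩
    rw [hzero, Finset.sum_range_succ'] at hwt
    simp [hammingWt] at hwt
  exact ⟨hex, Nat.sInf_le hex⟩
end

section
/- Let ℓ, a, s be natural numbers with s ≥ 1 and let T be a finset of Fin ℓ with |T| = s. Then, as integers, the number of vectors v : Fin ℓ → ZMod 2 with exactly a nonzero coordinates such that the cardinality of {i ∈ T : v i = 1} is odd equals ∑_{t=1}^{s} (−2)^{t−1} · ∑_{U ⊆ T, |U| = t} N(U), where N(U) denotes the number of vectors v : Fin ℓ → ZMod 2 with exactly a nonzero coordinates satisfying v i = 1 for all i ∈ U. (This is the Hamming weight of the sum of the s rows of the block B_{1a} of the generating matrix corresponding to the degree-one monomials indexed by T.) -/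
open Finset

/-- Inclusion-exclusion for the parity indicator: the binomial expansion of `(1 - 2) ^ m`. -/
theorem sum_neg_two_pow_mul_choose {m s : ℕ} (h : m ≤ s) :
    ∑ t ∈ Icc 1 s, (-2 : ℤ) ^ (t - 1) * (m.choose t : ℤ) = if Odd m then 1 else 0 := by
  have expand : ∑ t ∈ range (s + 1), (-2 : ℤ) ^ t * (m.choose t : ℤ) = (-1) ^ m := by
    rw [show (-1 : ℤ) = -2 + 1 by norm_num, add_pow]
    simp only [one_pow, mul_one]
    refine (sum_subset (range_mono (by omega)) fun t _ ht => ?_).symm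
    rw [Nat.choose_eq_zero_of_lt (by simpa using ht)]
    simp
  have shift : ∑ t ∈ Icc 1 s, (-2 : ℤ) ^ (t - 1) * (m.choose t : ℤ) =
      ∑ t ∈ range s, (-2 : ℤ) ^ t * (m.choose (t + 1) : ℤ) := by
    rw [← Finset.Ico_add_one_right_eq_Icc, sum_Ico_eq_sum_range]
    simp [add_comm]
  rw [sum_range_succ'] at expand
  simp only [pow_succ', mul_assoc, ← mul_sum] at expand
  rw [shift]
  split_ifs with hm
  · rw [hm.neg_one_pow] at expand
    simp at expand
    linarith
  · rw [(Nat.not_odd_iff_even.mp hm).neg_one_pow] at expand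
    simp at expand
    simpa using expand

/-- The `t`-subsets of `T` all of whose elements satisfy `p` are counted by a binomial
coefficient. -/
theorem sum_powersetCard_ite_forall {α : Type*} (T : Finset α) (p : α → Prop) [DecidablePred p]
    [∀ U : Finset α, Decidable (∀ i ∈ U, p i)] (t : ℕ) :
    ∑ U ∈ T.powersetCard t, (if ∀ i ∈ U, p i then (1 : ℤ) else 0) =
      ((T.filter p).card.choose t : ℤ) := by
  rw [sum_boole, ← card_powersetCard]
  congr 2
  ext U
  simp only [mem_filter, mem_powersetCard, subset_iff]
  grind

theorem weight_of_sum_of_rows_block (ℓ a s : ℕ) (hs : 1 ≤ s)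
    (T : Finset (Fin ℓ)) (hT : T.card = s) :
    ((univ.filter fun v : Fin ℓ → ZMod 2 =>
        (suppF v).card = a ∧ Odd (T.filter fun i => v i = 1).card).card : ℤ) =
      ∑ t ∈ Icc 1 s, (-2 : ℤ) ^ (t - 1) *
        ∑ U ∈ T.powersetCard t,
          ((univ.filter fun v : Fin ℓ → ZMod 2 =>
              (suppF v).card = a ∧ ∀ i ∈ U, v i = 1).card : ℤ) := by
  simp only [natCast_card_filter, ite_and]
  simp_rw [sum_comm (s := T.powersetCard _), mul_sum]
  rw [sum_comm]
  refine sum_congr rfl fun v _ => ?_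
  by_cases hv : (suppF v).card = a
  · simp only [hv, if_true, ← mul_sum, sum_powersetCard_ite_forall T (fun i => v i = 1)]
    exact (sum_neg_two_pow_mul_choose (hT ▸ card_filter_le _ _)).symm
  · simp [hv]
end

section
/- Let s, i be natural numbers with 1 ≤ i ≤ s, and define g_i^s = ∑_{t=1}^{i} C(s−t, i−t) · C(s, t) · (−2)^{t−1} in the integers. Then g_i^s = C(s, i) if i is odd, and g_i^s = 0 if i is even. (Note: the displayed statement of Lemma 2.8 in the paper swaps the parities, but its own proof establishes the parity assignment stated here, e.g. g_1^s = s = C(s,1) and g_2^s = 0.) -/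
open Finset

/-- The alternating sum `∑ C(s-t, i-t) C(s, t) (-2)^(t-1)`, multiplied by `-2`, in closed form. -/
theorem neg_two_mul_sum_choose_mul_choose (s i : ℕ) :
    (-2 : ℤ) * ∑ t ∈ Icc 1 i,
        ((s - t).choose (i - t) : ℤ) * (s.choose t : ℤ) * (-2 : ℤ) ^ (t - 1) =
      (s.choose i : ℤ) * ((-1) ^ i - 1) := by
  have binomial : ((-1 : ℤ)) ^ i = ∑ t ∈ range (i + 1), (-2 : ℤ) ^ t * (i.choose t : ℤ) := by
    simpa using add_pow (-2 : ℤ) 1 i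
  rw [range_eq_Ico, sum_eq_sum_Ico_succ_bot (Nat.succ_pos i)] at binomial
  have interval : Ico (0 + 1) (i + 1) = Icc 1 i := by ext; simp
  rw [interval] at binomial
  rw [binomial, pow_zero, Nat.choose_zero_right, Nat.cast_one, mul_one, add_sub_cancel_left,
    mul_sum, mul_sum]
  refine sum_congr rfl fun t ht => ?_
  obtain ⟨h1, hti⟩ := mem_Icc.mp ht
  have trinomial : (s.choose i : ℤ) * i.choose t = s.choose t * (s - t).choose (i - t) := by
    exact_mod_cast Nat.choose_mul hti
  have power : (-2 : ℤ) ^ t = -2 * (-2) ^ (t - 1) := by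
    rw [← pow_succ', Nat.sub_add_cancel h1]
  rw [power]
  linear_combination (2 * (-2 : ℤ) ^ (t - 1)) * trinomial

theorem technical_lemma_g (s i : ℕ) (hi1 : 1 ≤ i) (his : i ≤ s) :
    (Odd i →
        ∑ t ∈ Icc 1 i, ((s - t).choose (i - t) : ℤ) * (s.choose t : ℤ) * (-2 : ℤ) ^ (t - 1) =
          (s.choose i : ℤ)) ∧
      (Even i →
        ∑ t ∈ Icc 1 i, ((s - t).choose (i - t) : ℤ) * (s.choose t : ℤ) * (-2 : ℤ) ^ (t - 1) =
          0) := by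
  have closed_form := neg_two_mul_sum_choose_mul_choose s i
  constructor
  · intro h
    rw [h.neg_one_pow] at closed_form
    linarith
  · intro h
    rw [h.neg_one_pow] at closed_form
    linarith
end

section
/- Let s, i be natural numbers with s ≥ 1 and i ≥ 1, and define d_i^s = (s−1)·C(s−1, i−1) + ∑_{t=2}^{i} (−2)^{t−1} · C(s, t) · C(s−t, i−t) in the integers. Then d_i^s = C(s−1, i) when i is odd, and d_i^s = −C(s−1, i−1) when i is even; in particular, for every m ≥ 1, d_{2m}^s = −d_{2m−1}^s. (Note: the paper records these values with the parities interchanged due to the sign error in its Lemma 2.8; the values stated here are the ones consistent with the definition, e.g. d_1^s = s−1 = C(s−1,1) and d_2^s = −(s−1) = −C(s−1,1).) -/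
open Finset

/-- The integer `d_i^s` from the proof of the main theorem. -/
def dCoeff (s i : ℕ) : ℤ :=
  ((s : ℤ) - 1) * ((s - 1).choose (i - 1) : ℤ) +
    ∑ t ∈ Icc 2 i, (-2 : ℤ) ^ (t - 1) * (s.choose t : ℤ) * ((s - t).choose (i - t) : ℤ)

theorem sum_neg_two_pow_mul_choose_s11 (i : ℕ) :
    ∑ t ∈ range (i + 1), (-2 : ℤ) ^ t * (i.choose t : ℤ) = (-1) ^ i := by
  simpa using (add_pow (-2 : ℤ) 1 i).symm

theorem neg_two_mul_sum_Icc_two {i : ℕ} (hi : 1 ≤ i) :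
    -2 * ∑ t ∈ Icc 2 i, (-2 : ℤ) ^ (t - 1) * (i.choose t : ℤ) = (-1) ^ i - 1 + 2 * i := by
  have hsplit : range (i + 1) = insert 0 (insert 1 (Icc 2 i)) := by
    ext t
    simp only [mem_range, mem_insert, mem_Icc]
    omega
  have hsum := sum_neg_two_pow_mul_choose_s11 i
  rw [hsplit, sum_insert (by simp), sum_insert (by simp)] at hsum
  have hshift : -2 * ∑ t ∈ Icc 2 i, (-2 : ℤ) ^ (t - 1) * (i.choose t : ℤ) =
      ∑ t ∈ Icc 2 i, (-2 : ℤ) ^ t * (i.choose t : ℤ) := by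
    rw [mul_sum]
    refine sum_congr rfl fun t ht => ?_
    rw [← mul_assoc, mul_pow_sub_one (by have := (mem_Icc.1 ht).1; omega)]
  simp only [pow_zero, pow_one, Nat.choose_zero_right, Nat.choose_one_right] at hsum
  rw [hshift]
  push_cast at hsum
  linarith

theorem neg_two_mul_dCoeff {s i : ℕ} (hs : 1 ≤ s) (hi : 1 ≤ i) :
    -2 * dCoeff s i =
      2 * ((s - 1).choose (i - 1) : ℤ) + (s.choose i : ℤ) * ((-1) ^ i - 1) := by
  have hfactor : ∑ t ∈ Icc 2 i,
      (-2 : ℤ) ^ (t - 1) * (s.choose t : ℤ) * ((s - t).choose (i - t) : ℤ) =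
      (s.choose i : ℤ) * ∑ t ∈ Icc 2 i, (-2 : ℤ) ^ (t - 1) * (i.choose t : ℤ) := by
    rw [mul_sum]
    refine sum_congr rfl fun t ht => ?_
    have h : (s.choose i : ℤ) * i.choose t = s.choose t * (s - t).choose (i - t) :=
      mod_cast Nat.choose_mul (mem_Icc.1 ht).2
    linear_combination -(-2 : ℤ) ^ (t - 1) * h
  have habsorb : (s : ℤ) * ((s - 1).choose (i - 1) : ℤ) = s.choose i * i := by
    obtain ⟨s, rfl⟩ := Nat.exists_eq_add_of_le' hs
    obtain ⟨i, rfl⟩ := Nat.exists_eq_add_of_le' hi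
    exact mod_cast Nat.add_one_mul_choose_eq s i
  rw [dCoeff, hfactor]
  linear_combination (s.choose i : ℤ) * neg_two_mul_sum_Icc_two hi - 2 * habsorb

theorem dCoeff_of_even {s i : ℕ} (hs : 1 ≤ s) (hi : 1 ≤ i) (h : Even i) :
    dCoeff s i = -((s - 1).choose (i - 1) : ℤ) := by
  have hd := neg_two_mul_dCoeff hs hi
  rw [h.neg_one_pow] at hd
  linarith

theorem dCoeff_of_odd {s i : ℕ} (hs : 1 ≤ s) (h : Odd i) :
    dCoeff s i = ((s - 1).choose i : ℤ) := by
  have hd := neg_two_mul_dCoeff hs h.pos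
  have hpascal : (s.choose i : ℤ) = (s - 1).choose (i - 1) + (s - 1).choose i :=
    mod_cast Nat.choose_eq_choose_pred_add hs h.pos
  rw [h.neg_one_pow] at hd
  linarith

theorem d_coefficients (s i : ℕ) (hs : 1 ≤ s) (hi : 1 ≤ i) :
    (Odd i → dCoeff s i = ((s - 1).choose i : ℤ)) ∧
      (Even i → dCoeff s i = -(((s - 1).choose (i - 1) : ℤ))) ∧
      (∀ m : ℕ, 1 ≤ m → dCoeff s (2 * m) = -dCoeff s (2 * m - 1)) := by
  refine ⟨dCoeff_of_odd hs, dCoeff_of_even hs hi, fun m hm => ?_⟩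
  rw [dCoeff_of_even hs (by omega) (even_two_mul m),
    dCoeff_of_odd hs ⟨m - 1, by omega⟩]
end

section
/- Fix natural numbers ℓ, h, n with n ≥ 1, and let σ₁, …, σ_n be finsets of Fin ℓ. Then, as integers, B(σ₁,…,σ_n) = ∑_{e=1}^{n} (−2)^{e−1} · ∑_{I ⊆ {1,…,n}, |I| = e} W(⋃_{i ∈ I} σ_i), where the inner sum is over all e-element subsets I of the index set {1,…,n}. -/
open Finset

/-- `B h σ` is the number of vectors `v : Fin ℓ → ZMod 2` with `|supp v| ≤ h` such that
the number of indices `i` with `σ i ⊆ supp v` is odd: the Hamming weight of the codeword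
obtained by evaluating `Σ_i Π_{k ∈ σ i} x_k` at all points of Hamming weight at most `h`. -/
def B {ℓ : ℕ} (h : ℕ) {n : ℕ} (σ : Fin n → Finset (Fin ℓ)) : ℕ :=
  (univ.filter fun v : Fin ℓ → ZMod 2 =>
    (suppF v).card ≤ h ∧ Odd (univ.filter fun i : Fin n => σ i ⊆ suppF v).card).card

/-- `W h τ` is the number of vectors `v : Fin ℓ → ZMod 2` with `|supp v| ≤ h` and
`τ ⊆ supp v`. -/
def W {ℓ : ℕ} (h : ℕ) (τ : Finset (Fin ℓ)) : ℕ :=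
  (univ.filter fun v : Fin ℓ → ZMod 2 => (suppF v).card ≤ h ∧ τ ⊆ suppF v).card

/-- A binomial expansion of the parity indicator, from `(1 - 2) ^ t = (-1) ^ t`. -/
theorem sum_Icc_neg_two_pow_mul_choose {t n : ℕ} (htn : t ≤ n) :
    ∑ e ∈ Icc 1 n, (-2 : ℤ) ^ (e - 1) * (t.choose e : ℤ) = if Odd t then 1 else 0 := by
  have hbinom : ∑ e ∈ range (n + 1), (-2 : ℤ) ^ e * (t.choose e : ℤ) = (-1) ^ t := by
    have hsub : range (t + 1) ⊆ range (n + 1) := range_subset_range.2 (by omega)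
    rw [← sum_subset hsub]
    · simpa using (add_pow (-2 : ℤ) 1 t).symm
    · intro e _ he
      rw [Nat.choose_eq_zero_of_lt (by simpa [Nat.lt_succ_iff] using he)]
      simp
  have hshift : ∑ e ∈ Icc 1 n, (-2 : ℤ) ^ (e - 1) * (t.choose e : ℤ) =
      ∑ e ∈ range n, (-2 : ℤ) ^ e * (t.choose (e + 1) : ℤ) := by
    rw [show Icc 1 n = Ico 1 (n + 1) by ext; simp, sum_Ico_eq_sum_range]
    simp [add_comm]
  rw [sum_range_succ'] at hbinom
  simp only [pow_succ', mul_assoc, ← mul_sum, ← hshift] at hbinom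
  split_ifs with ht
  · rw [ht.neg_one_pow] at hbinom
    simp at hbinom
    linarith
  · rw [(Nat.not_odd_iff_even.1 ht).neg_one_pow] at hbinom
    simp at hbinom
    simpa using hbinom

/-- The number of `e`-subsets of the index set whose union lies in `s`. -/
theorem card_filter_powersetCard_sup_subset {ι α : Type*} [Fintype ι] [DecidableEq α]
    (σ : ι → Finset α) (s : Finset α) (e : ℕ) :
    #{I ∈ (univ : Finset ι).powersetCard e | I.sup σ ⊆ s} =
      (#{i : ι | σ i ⊆ s}).choose e := by
  rw [← card_powersetCard]
  congr 1
  ext I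
  simp only [mem_filter, mem_powersetCard, subset_univ, true_and, Finset.sup_le_iff]
  simp [subset_iff, and_comm]

theorem B_inclusion_exclusion {ℓ : ℕ} (h n : ℕ) (hn : 1 ≤ n)
    (σ : Fin n → Finset (Fin ℓ)) :
    (B h σ : ℤ) =
      ∑ e ∈ Icc 1 n, (-2 : ℤ) ^ (e - 1) *
        ∑ I ∈ (univ : Finset (Fin n)).powersetCard e, (W h (I.sup σ) : ℤ) := by
  have hW (e : ℕ) : ∑ I ∈ (univ : Finset (Fin n)).powersetCard e, (W h (I.sup σ) : ℤ) =
      ∑ v : Fin ℓ → ZMod 2 with #(suppF v) ≤ h, ((#{i | σ i ⊆ suppF v}).choose e : ℤ) := by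
    simp only [← card_filter_powersetCard_sup_subset]
    simp only [W, ← filter_filter, card_filter, Nat.cast_sum]
    exact sum_comm
  simp only [hW, mul_sum]
  rw [sum_comm, B, ← filter_filter, card_filter, Nat.cast_sum]
  refine sum_congr rfl fun v _ => ?_
  rw [sum_Icc_neg_two_pow_mul_choose ((card_le_univ _).trans_eq (Fintype.card_fin n))]
  simp
end

section
/- Let ℓ, h, j be natural numbers with 1 < j ≤ h ≤ ℓ, and let σ₁, σ₂ be finsets of Fin ℓ with σ₁ ≠ σ₂, |σ₁| ≤ j and |σ₂| ≤ j. Then, as integers, B(σ₁, σ₂) ≥ ∑_{i=1}^{h−j} C(ℓ−j, i). -/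
open Finset

/-- The sets of size at most `h` that contain `σ` and avoid `x`. -/
def supersetsAvoiding {ℓ : ℕ} (h : ℕ) (σ : Finset (Fin ℓ)) (x : Fin ℓ) :
    Finset (Finset (Fin ℓ)) :=
  univ.filter fun S => S.card ≤ h ∧ σ ⊆ S ∧ x ∉ S

lemma mem_supersetsAvoiding {ℓ h : ℕ} {σ S : Finset (Fin ℓ)} {x : Fin ℓ} :
    S ∈ supersetsAvoiding h σ x ↔ S.card ≤ h ∧ σ ⊆ S ∧ x ∉ S := by
  simp [supersetsAvoiding]

lemma sum_choose_le_card_supersetsAvoiding {ℓ h : ℕ} {σ : Finset (Fin ℓ)} {x : Fin ℓ}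
    (hx : x ∉ σ) (hσ : σ.card ≤ h) :
    ∑ i ∈ range (h - σ.card + 1), (ℓ - (σ.card + 1)).choose i
      ≤ (supersetsAvoiding h σ x).card := by
  have hc : ((insert x σ)ᶜ).card = ℓ - (σ.card + 1) := by
    rw [card_compl, card_insert_of_notMem hx, Fintype.card_fin]
  have hdisj : ∀ T ⊆ (insert x σ)ᶜ, Disjoint σ T ∧ x ∉ T := fun T hT =>
    ⟨disjoint_left.2 fun a ha haT => by simpa [ha] using hT haT,
      fun hxT => by simpa using hT hxT⟩
  simp_rw [← hc, ← card_powersetCard, ← card_sigma]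
  refine card_le_card_of_injOn (fun p => σ ∪ p.2) ?_ ?_
  · rintro ⟨i, T⟩ hp
    simp only [coe_sigma, Set.mem_sigma_iff, mem_coe, mem_range, mem_powersetCard] at hp
    obtain ⟨hi, hT, rfl⟩ := hp
    rw [mem_coe, mem_supersetsAvoiding]
    refine ⟨(card_union_le σ T).trans (by omega), subset_union_left, ?_⟩
    simp [hx, (hdisj T hT).2]
  · rintro ⟨i, T⟩ hp ⟨i', T'⟩ hp' heq
    simp only [coe_sigma, Set.mem_sigma_iff, mem_coe, mem_range, mem_powersetCard] at hp hp'
    obtain ⟨-, hT, rfl⟩ := hp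
    obtain ⟨-, hT', rfl⟩ := hp'
    have hTT : T = T' := by
      have := congrArg (· \ σ) heq
      simpa [union_sdiff_cancel_left, (hdisj T hT).1, (hdisj T' hT').1] using this
    subst hTT
    rfl

lemma card_le_B_pair {ℓ h : ℕ} {σ₁ σ₂ : Finset (Fin ℓ)} {F : Finset (Finset (Fin ℓ))}
    (hF : ∀ S ∈ F, S.card ≤ h ∧ (σ₁ ⊆ S ∧ ¬ σ₂ ⊆ S ∨ σ₂ ⊆ S ∧ ¬ σ₁ ⊆ S)) :
    F.card ≤ B h ![σ₁, σ₂] := by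
  have hsupp : ∀ S : Finset (Fin ℓ), suppF (fun i => if i ∈ S then (1 : ZMod 2) else 0) = S := by
    intro S
    ext i
    simp [suppF]
  refine card_le_card_of_injOn (fun S i => if i ∈ S then (1 : ZMod 2) else 0) ?_ ?_
  · intro S hS
    obtain ⟨hcard, hor⟩ := hF S hS
    simp only [coe_filter, mem_univ, true_and, Set.mem_ofPred_eq, hsupp]
    refine ⟨hcard, ?_⟩
    rw [card_filter, Fin.sum_univ_two]
    rcases hor with ⟨ha, hb⟩ | ⟨ha, hb⟩ <;> simp [ha, hb]
  · intro S _ T _ hST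
    rw [← hsupp S, ← hsupp T]
    exact congrArg suppF hST

lemma sum_Icc_choose_succ_le (n k : ℕ) :
    ∑ i ∈ Icc 1 k, (n + 1).choose i ≤ 2 * ∑ i ∈ range (k + 1), n.choose i := by
  have hIcc : ∑ i ∈ Icc 1 k, (n + 1).choose i = ∑ i ∈ range k, (n + 1).choose (i + 1) := by
    rw [range_eq_Ico, sum_Ico_add' (fun i => (n + 1).choose i) 0 k 1]
    rfl
  simp_rw [hIcc, Nat.choose_succ_succ', sum_add_distrib]
  have hfst := sum_range_succ (fun i => n.choose i) k
  have hsnd := sum_range_succ' (fun i => n.choose i) k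
  omega

lemma sum_choose_le_B_pair_of_card_le {ℓ h j : ℕ} (hjh : j ≤ h)
    {σ₁ σ₂ : Finset (Fin ℓ)} (hne : σ₁ ≠ σ₂) (hle : σ₁.card ≤ σ₂.card) (h2 : σ₂.card ≤ j) :
    ∑ i ∈ Icc 1 (h - j), (ℓ - j).choose i ≤ B h ![σ₁, σ₂] := by
  obtain ⟨x, hx2, hx1⟩ := not_subset.1 fun hsub => hne (eq_of_subset_of_card_le hsub hle).symm
  have hcount := sum_choose_le_card_supersetsAvoiding (h := h) hx1 (by omega)
  rcases (hle.trans h2).lt_or_eq with hlt | heq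
  · calc ∑ i ∈ Icc 1 (h - j), (ℓ - j).choose i
        ≤ ∑ i ∈ range (h - σ₁.card + 1), (ℓ - j).choose i :=
          sum_le_sum_of_subset fun i hi => by
            rw [mem_Icc] at hi
            rw [mem_range]
            omega
      _ ≤ ∑ i ∈ range (h - σ₁.card + 1), (ℓ - (σ₁.card + 1)).choose i :=
          sum_le_sum fun i _ => Nat.choose_le_choose i (by omega)
      _ ≤ _ := hcount
      _ ≤ _ := card_le_B_pair fun S hS => by
          obtain ⟨hcard, hsub, hxS⟩ := mem_supersetsAvoiding.1 hS
          exact ⟨hcard, .inl ⟨hsub, fun hsub₂ => hxS (hsub₂ hx2)⟩⟩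
  · have heq2 : σ₂.card = j := by omega
    obtain ⟨y, hy1, hy2⟩ := not_subset.1 fun hsub =>
      hne (eq_of_subset_of_card_le hsub (by omega))
    have hcount' := sum_choose_le_card_supersetsAvoiding (h := h) hy2 (by omega)
    have hℓ : j + 1 ≤ ℓ := by
      have := card_le_univ (insert x σ₁)
      rwa [card_insert_of_notMem hx1, Fintype.card_fin, heq] at this
    have hdisj : Disjoint (supersetsAvoiding h σ₁ x) (supersetsAvoiding h σ₂ y) :=
      disjoint_left.2 fun S hS hS' =>
        (mem_supersetsAvoiding.1 hS).2.2 ((mem_supersetsAvoiding.1 hS').2.1 hx2)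
    have hB : (supersetsAvoiding h σ₁ x ∪ supersetsAvoiding h σ₂ y).card ≤ B h ![σ₁, σ₂] :=
      card_le_B_pair fun S hS => by
        rcases mem_union.1 hS with hS | hS <;>
          obtain ⟨hcard, hsub, hnot⟩ := mem_supersetsAvoiding.1 hS
        · exact ⟨hcard, .inl ⟨hsub, fun hsub₂ => hnot (hsub₂ hx2)⟩⟩
        · exact ⟨hcard, .inr ⟨hsub, fun hsub₁ => hnot (hsub₁ hy1)⟩⟩
    rw [card_union_of_disjoint hdisj] at hB
    rw [heq] at hcount
    rw [heq2] at hcount'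
    have hpascal := sum_Icc_choose_succ_le (ℓ - (j + 1)) (h - j)
    rw [show ℓ - (j + 1) + 1 = ℓ - j by omega] at hpascal
    omega

lemma B_pair_comm {ℓ : ℕ} (h : ℕ) (σ₁ σ₂ : Finset (Fin ℓ)) :
    B h ![σ₁, σ₂] = B h ![σ₂, σ₁] := by
  unfold B
  congr! 4 with v
  rw [card_filter, card_filter, Fin.sum_univ_two, Fin.sum_univ_two]
  exact add_comm _ _

theorem B_two_rows_lower_bound {ℓ : ℕ} (h j : ℕ) (hj : 1 < j) (hjh : j ≤ h) (hhl : h ≤ ℓ)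
    (σ₁ σ₂ : Finset (Fin ℓ)) (hne : σ₁ ≠ σ₂)
    (h1 : σ₁.card ≤ j) (h2 : σ₂.card ≤ j) :
    ∑ i ∈ Icc 1 (h - j), ((ℓ - j).choose i : ℤ) ≤ (B h ![σ₁, σ₂] : ℤ) := by
  rcases le_total σ₁.card σ₂.card with hle | hle
  · exact_mod_cast sum_choose_le_B_pair_of_card_le hjh hne hle h2
  · rw [B_pair_comm]
    exact_mod_cast sum_choose_le_B_pair_of_card_le hjh hne.symm hle h1
end

section
/- Fix natural numbers ℓ, h, n with n ≥ 2, and let σ₁, …, σ_n be finsets of Fin ℓ. Then, as integers, B(σ₁,…,σ_n) = B(σ₁,…,σ_{n−1}) + B(σ_n) − 2 · B(σ₁∪σ_n, σ₂∪σ_n, …, σ_{n−1}∪σ_n). -/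
open Finset

/-- Splitting off the last index from the number of sets contained in `s`. -/
theorem card_filter_subset_succ {α : Type*} [DecidableEq α] {n : ℕ}
    (σ : Fin (n + 1) → Finset α) (s : Finset α) :
    #{i | σ i ⊆ s} =
      #{i : Fin n | σ i.castSucc ⊆ s} + if σ (Fin.last n) ⊆ s then 1 else 0 := by
  simp only [card_filter, Fin.sum_univ_castSucc]

theorem B_recursion {ℓ : ℕ} (h n : ℕ) (hn : 1 ≤ n)
    (σ : Fin (n + 1) → Finset (Fin ℓ)) :
    (B h σ : ℤ) =
      (B h (fun i : Fin n => σ i.castSucc) : ℤ) + (W h (σ (Fin.last n)) : ℤ) -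
        2 * (B h (fun i : Fin n => σ i.castSucc ∪ σ (Fin.last n)) : ℤ) := by
  simp only [B, W, card_filter_subset_succ σ, union_subset_iff]
  simp only [card_filter _ (univ : Finset (Fin ℓ → ZMod 2)), Nat.cast_sum, mul_sum,
    ← sum_add_distrib, ← sum_sub_distrib]
  refine sum_congr rfl fun v _ => ?_
  by_cases hv : #(suppF v) ≤ h <;> by_cases hlast : σ (Fin.last n) ⊆ suppF v <;>
    by_cases hodd : Odd #{i : Fin n | σ i.castSucc ⊆ suppF v} <;>
    simp [hv, hlast, hodd, Nat.odd_add_one]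
end

section
/- Fix natural numbers ℓ, h, n, k with 1 ≤ k ≤ n, and let σ₁, …, σ_n be pairwise distinct finsets of Fin ℓ such that |σ₁| ≤ |σ₂| ≤ … ≤ |σ_k| ≤ |σ_{k+1}| = |σ_{k+2}| = … = |σ_n| and |σ_k| < (n − k) + |σ_n|. Then, as integers, B(σ₁,…,σ_n) ≥ B(σ_n) (where B(σ_n) = W(σ_n)). -/
open Finset

/-- If `τ ⊆ σ` fails, the subsets `T` of `τ` with `σ ⊆ S ∪ T` are even in number. -/
lemma even_card_filter_subset_union {α : Type*} [DecidableEq α] {σ τ S : Finset α}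
    (hS : Disjoint S τ) (hτ : ¬ τ ⊆ σ) :
    Even (#{T ∈ τ.powerset | σ ⊆ S ∪ T}) := by
  by_cases hσ : σ \ τ ⊆ S
  · have hIcc : {T ∈ τ.powerset | σ ⊆ S ∪ T} = Icc (σ ∩ τ) τ := by
      ext T
      simp only [mem_filter, mem_powerset, mem_Icc]
      rw [disjoint_left] at hS
      constructor
      · rintro ⟨hT, h⟩
        refine ⟨fun x hx => ?_, hT⟩
        have := @h x
        have := @hS x
        grind
      · rintro ⟨h, hT⟩
        refine ⟨hT, fun x hx => ?_⟩
        have := @h x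
        have := @hσ x
        grind
    rw [hIcc, card_Icc_finset inter_subset_right]
    have hlt : #(σ ∩ τ) < #τ :=
      card_lt_card ⟨inter_subset_right, fun h => hτ (h.trans inter_subset_left)⟩
    exact (even_two).pow_of_ne_zero (by omega)
  · rw [filter_false_of_mem, card_empty]
    · exact Even.zero
    · intro T hT h
      refine hσ fun x hx => ?_
      have := @h x
      grind

/-- If only one member of the family contains `τ`, and that member is `τ` itself, then some
subset `T` of `τ` makes the number of members contained in `S ∪ T` odd. -/
lemma exists_odd_card_filter_subset_union {α ι : Type*} [DecidableEq α] [Fintype ι]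
    (σ : ι → Finset α) (m : ι) (hm : ∀ i, σ m ⊆ σ i → i = m) {S : Finset α}
    (hS : Disjoint S (σ m)) :
    ∃ T ⊆ σ m, Odd (#{i | σ i ⊆ S ∪ T}) := by
  classical
  by_contra! hcon
  have heven : Even (∑ T ∈ (σ m).powerset, #{i | σ i ⊆ S ∪ T}) :=
    even_sum _ fun T hT => Nat.not_odd_iff_even.1 (hcon T (mem_powerset.1 hT))
  have hswap : ∑ T ∈ (σ m).powerset, #{i | σ i ⊆ S ∪ T} =
      ∑ i, #{T ∈ (σ m).powerset | σ i ⊆ S ∪ T} :=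
    sum_card_bipartiteAbove_eq_sum_card_bipartiteBelow (fun T i => σ i ⊆ S ∪ T)
  have hone : {T ∈ (σ m).powerset | σ m ⊆ S ∪ T} = {σ m} := by
    ext T
    simp only [mem_filter, mem_powerset, mem_singleton]
    constructor
    · rintro ⟨hT, h⟩
      exact hT.antisymm (hS.symm.left_le_of_le_sup_left h)
    · rintro rfl
      exact ⟨Subset.rfl, subset_union_right⟩
  rw [hswap, ← add_sum_erase _ _ (mem_univ m), hone, card_singleton] at heven
  have hrest : Even (∑ i ∈ univ.erase m, #{T ∈ (σ m).powerset | σ i ⊆ S ∪ T}) :=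
    even_sum _ fun i hi => even_card_filter_subset_union hS
      fun h => ne_of_mem_erase hi (hm i h)
  grind

/-- The weight of a family is at least that of any member contained in no other member. -/
lemma W_le_B_of_maximal {ℓ n : ℕ} (h : ℕ) (σ : Fin n → Finset (Fin ℓ)) (m : Fin n)
    (hm : ∀ i, σ m ⊆ σ i → i = m) : W h (σ m) ≤ B h σ := by
  unfold W B
  refine card_le_card_of_surjOn (fun v i => if i ∈ σ m then 1 else v i) ?_
  intro w hw
  simp only [coe_filter, mem_univ, true_and, Set.mem_ofPred_eq] at hw
  obtain ⟨hcard, hsub⟩ := hw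
  obtain ⟨T, hT, hodd⟩ := exists_odd_card_filter_subset_union σ m hm
    (S := suppF w \ σ m) sdiff_disjoint
  have hsupp : suppF (fun i => if i ∈ suppF w \ σ m ∪ T then (1 : ZMod 2) else 0) =
      suppF w \ σ m ∪ T := by
    ext i
    simp only [suppF, mem_filter_univ, ite_ne_right_iff, ne_eq, one_ne_zero, not_false_eq_true,
      and_true]
  refine ⟨fun i => if i ∈ suppF w \ σ m ∪ T then 1 else 0, ?_, ?_⟩
  · simp only [coe_filter, mem_univ, true_and, Set.mem_ofPred_eq, hsupp]
    exact ⟨(card_le_card (union_subset sdiff_subset (hT.trans hsub))).trans hcard, hodd⟩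
  · have hone : ∀ a : ZMod 2, a ≠ 0 → a = 1 := by decide
    have hmem : ∀ i, i ∈ suppF w ↔ w i ≠ 0 := fun i => by simp [suppF]
    funext i
    have := hone (w i)
    have := hmem i
    have := @hsub i
    have := @hT i
    grind

theorem B_many_rows_lower_bound {ℓ : ℕ} (h n k : ℕ) (hk1 : 1 ≤ k) (hkn : k ≤ n)
    (σ : Fin n → Finset (Fin ℓ)) (hdist : Function.Injective σ)
    (hmono : ∀ i j : Fin n, i ≤ j → (σ i).card ≤ (σ j).card)
    (hconst : ∀ i : Fin n, k ≤ (i : ℕ) → (σ i).card = (σ ⟨n - 1, by omega⟩).card)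
    (hlt : (σ ⟨k - 1, by omega⟩).card < (n - k) + (σ ⟨n - 1, by omega⟩).card) :
    (W h (σ ⟨n - 1, by omega⟩) : ℤ) ≤ (B h σ : ℤ) := by
  have hlast : k ≠ n := by
    rintro rfl
    simp at hlt
  exact_mod_cast W_le_B_of_maximal h σ ⟨n - 1, by omega⟩ fun i hi =>
    (hdist (eq_of_subset_of_card_le hi (hmono i _ (Fin.mk_le_mk.2 (by omega))))).symm
end

section
/- Let ℓ be a natural number with ℓ ≥ 3, and consider the binary skeleton code K(ℓ, ℓ−1, ℓ−2). Then: (a) its length is 2^ℓ − 1, i.e., the number of vectors v : Fin ℓ → ZMod 2 with at most ℓ−1 nonzero coordinates is 2^ℓ − 1; (b) its dimension over ZMod 2 (finrank) is 2^ℓ − 1 − ℓ; and (c) its minimum distance is 3, i.e., every nonzero codeword has Hamming weight at least 3 and some codeword has Hamming weight exactly 3. (Hence K(ℓ, ℓ−1, ℓ−2) has the parameters [2^ℓ−1, 2^ℓ−1−ℓ, 3]₂ of the binary Hamming code, to which it is permutation equivalent.) -/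
open Finset

theorem zmod_two_eq_one_iff_ne_zero {a : ZMod 2} : a = 1 ↔ a ≠ 0 := by
  revert a
  decide

theorem pi_zmod_two_add_eq_zero {ι : Type*} {v w : ι → ZMod 2} : v + w = 0 ↔ v = w := by
  simp only [funext_iff, Pi.add_apply, Pi.zero_apply, CharTwo.add_eq_zero]

/-- A vector over `ZMod 2` misses at least one coordinate iff it is not the all-ones vector. -/
theorem suppCard_le_pred_iff {ℓ : ℕ} (hℓ : 0 < ℓ) (v : Fin ℓ → ZMod 2) :
    suppCard v ≤ ℓ - 1 ↔ v ≠ 1 := by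
  have hle : suppCard v ≤ ℓ := (card_le_univ _).trans_eq (Fintype.card_fin ℓ)
  have hone : suppCard v = ℓ ↔ v = 1 := by
    have h := card_eq_iff_eq_univ (univ.filter fun i => v i ≠ 0)
    rw [Fintype.card_fin] at h
    rw [suppCard, h, eq_univ_iff_forall, funext_iff]
    simp [zmod_two_eq_one_iff_ne_zero]
  rw [← not_iff_not, not_not, ← hone]
  omega

theorem card_suppCard_le_pred {ℓ : ℕ} (hℓ : 0 < ℓ) :
    Fintype.card {v : Fin ℓ → ZMod 2 // suppCard v ≤ ℓ - 1} = 2 ^ ℓ - 1 := by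
  rw [Fintype.card_congr (Equiv.subtypeEquivRight (suppCard_le_pred_iff hℓ)),
    Fintype.card_subtype_compl]
  simp [ZMod.card]

/-- The Hamming syndrome of a word on the `h`-skeleton: the point `p` has parity-check
column `p + 1`. -/
noncomputable def skelSyndrome (ℓ h : ℕ) :
    ({v : Fin ℓ → ZMod 2 // suppCard v ≤ h} → ZMod 2) →ₗ[ZMod 2] (Fin ℓ → ZMod 2) :=
  Fintype.linearCombination (ZMod 2) fun p => p.1 + 1

theorem skelSyndrome_apply {ℓ h : ℕ} (c : {v : Fin ℓ → ZMod 2 // suppCard v ≤ h} → ZMod 2) :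
    skelSyndrome ℓ h c = ∑ p, c p • (p.1 + 1) :=
  Fintype.linearCombination_apply ..

theorem skelSyndrome_single {ℓ h : ℕ} (p : {v : Fin ℓ → ZMod 2 // suppCard v ≤ h}) :
    skelSyndrome ℓ h (Pi.single p 1) = p.1 + 1 := by
  simp [skelSyndrome, Fintype.linearCombination_apply_single]

/-- A nonzero vector `v` is the parity-check column of the point `v + 1`. -/
theorem suppCard_add_one_le_pred {ℓ : ℕ} (hℓ : 0 < ℓ) {v : Fin ℓ → ZMod 2} (hv : v ≠ 0) :
    suppCard (v + 1) ≤ ℓ - 1 :=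
  (suppCard_le_pred_iff hℓ _).2 fun h => hv (by simpa using h)

theorem add_one_add_one_zmod_two {ℓ : ℕ} (v : Fin ℓ → ZMod 2) : v + 1 + 1 = v := by
  rw [add_assoc, pi_zmod_two_add_eq_zero.2 rfl, add_zero]

theorem skelSyndrome_surjective {ℓ : ℕ} (hℓ : 0 < ℓ) :
    Function.Surjective (skelSyndrome ℓ (ℓ - 1)) := by
  intro v
  by_cases hv : v = 0
  · exact ⟨0, by simp [hv]⟩
  · exact ⟨Pi.single ⟨v + 1, suppCard_add_one_le_pred hℓ hv⟩ 1, by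
      rw [skelSyndrome_single, add_one_add_one_zmod_two]⟩

theorem finrank_ker_skelSyndrome {ℓ : ℕ} (hℓ : 0 < ℓ) :
    Module.finrank (ZMod 2) (skelSyndrome ℓ (ℓ - 1)).ker = 2 ^ ℓ - 1 - ℓ := by
  have h := (skelSyndrome ℓ (ℓ - 1)).finrank_range_add_finrank_ker
  rw [LinearMap.range_eq_top.2 (skelSyndrome_surjective hℓ), finrank_top, Module.finrank_pi,
    Module.finrank_pi, card_suppCard_le_pred hℓ, Fintype.card_fin] at h
  omega

theorem skelCode_le_ker_skelSyndrome {ℓ : ℕ} (hℓ : 2 ≤ ℓ) :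
    skelCode ℓ (ℓ - 1) (ℓ - 2) ≤ (skelSyndrome ℓ (ℓ - 1)).ker := by
  rintro _ ⟨f, hf, rfl⟩
  rw [SetLike.mem_coe, MvPolynomial.mem_restrictTotalDegree] at hf
  rw [LinearMap.mem_ker, skelSyndrome_apply]
  funext i
  have hdeg : (f * (MvPolynomial.X i + 1)).totalDegree
      < (Fintype.card (ZMod 2) - 1) * Fintype.card (Fin ℓ) := by
    have h1 := MvPolynomial.totalDegree_mul f (MvPolynomial.X i + 1)
    have h2 := MvPolynomial.totalDegree_add (MvPolynomial.X i : MvPolynomial (Fin ℓ) (ZMod 2)) 1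
    rw [MvPolynomial.totalDegree_X, MvPolynomial.totalDegree_one] at h2
    simp only [ZMod.card, Fintype.card_fin]
    omega
  have hsum := MvPolynomial.sum_eval_eq_zero _ hdeg
  rw [← Fintype.sum_subtype_add_sum_subtype (fun v => suppCard v ≤ ℓ - 1)] at hsum
  have hrest : ∑ v : {v : Fin ℓ → ZMod 2 // ¬ suppCard v ≤ ℓ - 1},
      MvPolynomial.eval v.1 (f * (MvPolynomial.X i + 1)) = 0 := by
    refine sum_eq_zero fun v _ => ?_
    have hv : v.1 = 1 := by
      by_contra h
      exact v.2 ((suppCard_le_pred_iff (by omega) _).2 h)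
    simp [hv, CharTwo.add_self_eq_zero]
  rw [hrest, add_zero] at hsum
  simpa [evalMap, mul_add] using hsum

theorem evalMap_surjective (ℓ h : ℕ) : Function.Surjective (evalMap ℓ h) := by
  intro c
  have htop := MvPolynomial.map_restrict_dom_evalₗ (ZMod 2) (Fin ℓ)
  obtain ⟨f, -, hf⟩ := htop.ge (Submodule.mem_top (x := fun v =>
    if hv : suppCard v ≤ h then c ⟨v, hv⟩ else 0))
  refine ⟨f, funext fun p => ?_⟩
  simpa [evalMap, p.2] using congrFun hf p.1

/-- Over `ZMod 2`, a monomial takes the same values as its squarefree part. -/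
theorem evalMap_monomial_one_s16 {ℓ : ℕ} (h : ℕ) (m : Fin ℓ →₀ ℕ) :
    evalMap ℓ h (MvPolynomial.monomial m 1) =
      evalMap ℓ h (∏ i ∈ m.support, MvPolynomial.X i) := by
  funext p
  simp only [evalMap, LinearMap.coe_mk, AddHom.coe_mk, MvPolynomial.eval_monomial, one_mul,
    map_prod, MvPolynomial.eval_X, Finsupp.prod]
  refine prod_congr rfl fun i hi => ?_
  have hidem : IsIdempotentElem (p.1 i) := by
    generalize p.1 i = a
    revert a
    unfold IsIdempotentElem
    decide
  exact hidem.pow_eq (Finsupp.mem_support_iff.1 hi)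

/-- Every word is a codeword plus a combination of the monomials omitting one variable. -/
theorem skelCode_sup_span_eq_top {ℓ : ℕ} (hℓ : 2 ≤ ℓ) :
    skelCode ℓ (ℓ - 1) (ℓ - 2) ⊔ Submodule.span (ZMod 2) (Set.range fun i : Fin ℓ =>
      evalMap ℓ (ℓ - 1) (∏ j ∈ univ.erase i, MvPolynomial.X j)) = ⊤ := by
  rw [eq_top_iff]
  rintro c -
  obtain ⟨f, rfl⟩ := evalMap_surjective ℓ (ℓ - 1) c
  rw [f.as_sum, map_sum]
  refine Submodule.sum_mem _ fun m _ => ?_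
  rw [← mul_one (f.coeff m), ← smul_eq_mul, ← MvPolynomial.smul_monomial, map_smul,
    evalMap_monomial_one_s16]
  refine Submodule.smul_mem _ _ ?_
  generalize m.support = S
  by_cases hS : S.card ≤ ℓ - 2
  · refine Submodule.mem_sup_left ⟨_, ?_, rfl⟩
    rw [SetLike.mem_coe, MvPolynomial.mem_restrictTotalDegree]
    refine (MvPolynomial.totalDegree_finsetProd _ _).trans ?_
    simpa using hS
  by_cases hu : S = univ
  · convert Submodule.zero_mem _
    funext p
    have hp := (suppCard_le_pred_iff (by omega) _).1 p.2
    obtain ⟨i, hi⟩ := Function.ne_iff.1 hp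
    have hi0 : p.1 i = 0 := by
      by_contra h
      exact hi (zmod_two_eq_one_iff_ne_zero.2 h)
    simpa [evalMap, hu] using prod_eq_zero (mem_univ i) hi0
  · obtain ⟨i, hi⟩ : ∃ i, i ∉ S := by simpa [eq_univ_iff_forall] using hu
    have hSi : S = univ.erase i := by
      refine eq_of_subset_of_card_le (fun j hj => ?_) ?_
      · exact mem_erase.2 ⟨fun h => hi (h ▸ hj), mem_univ j⟩
      · rw [card_erase_of_mem (mem_univ i), card_univ, Fintype.card_fin]
        omega
    exact Submodule.mem_sup_right (Submodule.subset_span ⟨i, by rw [hSi]⟩)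

/-- The skeleton code `K(ℓ, ℓ - 1, ℓ - 2)` is the Hamming code. -/
theorem skelCode_eq_ker_skelSyndrome {ℓ : ℕ} (hℓ : 2 ≤ ℓ) :
    skelCode ℓ (ℓ - 1) (ℓ - 2) = (skelSyndrome ℓ (ℓ - 1)).ker := by
  refine Submodule.eq_of_le_of_finrank_le (skelCode_le_ker_skelSyndrome hℓ) ?_
  have hsup := Submodule.finrank_add_le_finrank_add_finrank (skelCode ℓ (ℓ - 1) (ℓ - 2))
    (Submodule.span (ZMod 2) (Set.range fun i : Fin ℓ =>
      evalMap ℓ (ℓ - 1) (∏ j ∈ univ.erase i, MvPolynomial.X j)))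
  have hspan := finrank_range_le_card (R := ZMod 2) fun i : Fin ℓ =>
    evalMap ℓ (ℓ - 1) (∏ j ∈ univ.erase i, MvPolynomial.X j)
  rw [skelCode_sup_span_eq_top hℓ, finrank_top, Module.finrank_pi,
    card_suppCard_le_pred (by omega)] at hsup
  rw [Set.finrank, Fintype.card_fin] at hspan
  rw [finrank_ker_skelSyndrome (by omega)]
  omega

theorem three_le_hammingWt_of_mem_ker {ℓ : ℕ} (hℓ : 0 < ℓ)
    {c : {v : Fin ℓ → ZMod 2 // suppCard v ≤ ℓ - 1} → ZMod 2}
    (hc : c ∈ (skelSyndrome ℓ (ℓ - 1)).ker) (hc0 : c ≠ 0) : 3 ≤ hammingWt c := by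
  have hsum : ∑ p ∈ univ.filter (fun p => c p ≠ 0), (p.1 + 1) = 0 := by
    rw [LinearMap.mem_ker, skelSyndrome_apply] at hc
    rw [← hc, sum_filter]
    refine sum_congr rfl fun p _ => ?_
    by_cases hp : c p = 0
    · simp [hp]
    · simp [zmod_two_eq_one_iff_ne_zero.2 hp]
  by_contra! hlt
  unfold hammingWt at hlt
  interval_cases hcard : (univ.filter fun p => c p ≠ 0).card
  · rw [card_eq_zero, filter_eq_empty_iff] at hcard
    exact hc0 (funext fun p => not_not.1 (hcard (mem_univ p)))
  · obtain ⟨p, hp⟩ := card_eq_one.1 hcard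
    rw [hp, sum_singleton] at hsum
    exact (suppCard_le_pred_iff hℓ _).1 p.2 (pi_zmod_two_add_eq_zero.1 hsum)
  · obtain ⟨p, q, hpq, hp⟩ := card_eq_two.1 hcard
    rw [hp, sum_pair hpq, pi_zmod_two_add_eq_zero] at hsum
    exact hpq (Subtype.ext (add_right_cancel hsum))

theorem exists_mem_ker_hammingWt_eq_three {ℓ : ℕ} (hℓ : 2 ≤ ℓ) :
    ∃ c ∈ (skelSyndrome ℓ (ℓ - 1)).ker, hammingWt c = 3 := by
  let u : Fin ℓ → ZMod 2 := Pi.single ⟨0, by omega⟩ 1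
  let w : Fin ℓ → ZMod 2 := Pi.single ⟨1, by omega⟩ 1
  have hu : u ≠ 0 := by simp [u]
  have hw : w ≠ 0 := by simp [w]
  have huw : u ≠ w := fun h => by
    have := congrFun h ⟨0, by omega⟩
    simp [u, w] at this
  have huw0 : u + w ≠ 0 := fun h => huw (pi_zmod_two_add_eq_zero.1 h)
  let point (v : Fin ℓ → ZMod 2) (hv : v ≠ 0) : {v : Fin ℓ → ZMod 2 // suppCard v ≤ ℓ - 1} :=
    ⟨v + 1, suppCard_add_one_le_pred (by omega) hv⟩
  have hpoint {v v'} (hv : v ≠ 0) (hv' : v' ≠ 0) (h : v ≠ v') : point v hv ≠ point v' hv' :=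
    fun h' => h (add_right_cancel (congrArg Subtype.val h'))
  have h12 := hpoint hu hw huw
  have h13 := hpoint hu huw0 (by simpa using hw)
  have h23 := hpoint hw huw0 (by simpa using hu)
  refine ⟨Pi.single (point u hu) 1 + Pi.single (point w hw) 1 + Pi.single (point _ huw0) 1,
    ?_, ?_⟩
  · rw [LinearMap.mem_ker, map_add, map_add, skelSyndrome_single, skelSyndrome_single,
      skelSyndrome_single]
    simp only [point, add_one_add_one_zmod_two]
    exact pi_zmod_two_add_eq_zero.2 rfl
  · rw [hammingWt, card_eq_three]
    refine ⟨_, _, _, h12, h13, h23, ?_⟩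
    ext p
    simp only [mem_filter, mem_univ, true_and, mem_insert, mem_singleton, Pi.add_apply,
      Pi.single_apply]
    grind

theorem skeleton_hamming_parameters (ℓ : ℕ) (hℓ : 3 ≤ ℓ) :
    Fintype.card {v : Fin ℓ → ZMod 2 // suppCard v ≤ ℓ - 1} = 2 ^ ℓ - 1 ∧
      Module.finrank (ZMod 2) (skelCode ℓ (ℓ - 1) (ℓ - 2)) = 2 ^ ℓ - 1 - ℓ ∧
      (∀ c ∈ skelCode ℓ (ℓ - 1) (ℓ - 2), c ≠ 0 → 3 ≤ hammingWt c) ∧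
      (∃ c ∈ skelCode ℓ (ℓ - 1) (ℓ - 2), hammingWt c = 3) := by
  rw [skelCode_eq_ker_skelSyndrome (by omega)]
  exact ⟨card_suppCard_le_pred (by omega), finrank_ker_skelSyndrome (by omega),
    fun _ hc hc0 => three_le_hammingWt_of_mem_ker (by omega) hc hc0,
    exists_mem_ker_hammingWt_eq_three (by omega)⟩
end

section
/- Let ℓ, h, a be natural numbers with a < h ≤ ℓ. Then, in the integers, ∑_{i=1}^{h−a} C(ℓ−a, i) − 2 · ∑_{i=1}^{h−a−1} C(ℓ−a−1, i) = 1 + C(ℓ−a−1, h−a); in particular ∑_{i=1}^{h−a} C(ℓ−a, i) ≥ 2 · ∑_{i=1}^{h−a−1} C(ℓ−a−1, i), i.e., the Hamming weight of a row of the generating matrix of a skeleton code decreases by more than half when the degree of the corresponding monomial increases by one. -/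
open Finset

/-- Summing Pascal's rule: a partial row sum of binomial coefficients in terms of the row above. -/
theorem sum_Icc_choose_succ (n m : ℕ) :
    ∑ i ∈ Icc 1 (m + 1), ((n + 1).choose i : ℤ) =
      2 * ∑ i ∈ Icc 1 m, (n.choose i : ℤ) + (1 + (n.choose (m + 1) : ℤ)) := by
  induction m with
  | zero => simp [add_comm]
  | succ m ih =>
    rw [sum_Icc_succ_top (by omega), ih, sum_Icc_succ_top (by omega),
      Nat.choose_succ_succ' n (m + 1)]
    push_cast
    ring

theorem row_weight_halving (ℓ h a : ℕ) (hah : a < h) (hhl : h ≤ ℓ) :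
    (∑ i ∈ Icc 1 (h - a), ((ℓ - a).choose i : ℤ)) -
        2 * ∑ i ∈ Icc 1 (h - a - 1), ((ℓ - a - 1).choose i : ℤ) =
      1 + ((ℓ - a - 1).choose (h - a) : ℤ) ∧
    2 * (∑ i ∈ Icc 1 (h - a - 1), ((ℓ - a - 1).choose i : ℤ)) ≤
      ∑ i ∈ Icc 1 (h - a), ((ℓ - a).choose i : ℤ) := by
  obtain ⟨m, hm⟩ : ∃ m, h - a = m + 1 := ⟨h - a - 1, by omega⟩
  obtain ⟨n, hn⟩ : ∃ n, ℓ - a = n + 1 := ⟨ℓ - a - 1, by omega⟩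
  rw [hm, hn, Nat.add_sub_cancel, Nat.add_sub_cancel, sum_Icc_choose_succ]
  exact ⟨by ring, le_add_of_nonneg_right (by positivity)⟩
end
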